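/- Let n ≥ 1, 1 ≤ p ≤ 2, 0 < α ≤ n and s > (n−α)/2. Then there is a constant C > 0 such that for every finite Borel measure μ on ℝⁿ supported in B(0,1) with [μ]_α < ∞, every Schwartz function f on ℝⁿ and every t ∈ ℝ one has (∫_{ℝⁿ} |e^{it√(−Δ)}f(x)|^p dμ(x))^{1/p} ≤ C [μ]_α^{1/p} ‖f‖_{H^s}. -/

import Mathlib

open MeasureTheory Real Metric
open scoped ENNReal RealInnerProductSpace

noncomputable section

abbrev E (n : ℕ) : Type := EuclideanSpace ℝ (Fin n)

/-- The Frostman constant `[μ]_α = sup_{x,r>0} μ(B(x,r))/r^α`. -/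
def frostman {d : ℕ} (μ : Measure (E d)) (α : ℝ) : ℝ≥0∞ :=
  ⨆ (x : E d) (r : ℝ) (_ : 0 < r), μ (Metric.ball x r) / ENNReal.ofReal (r ^ α)

/-- The Fourier transform `f̂(ξ) = ∫ e^{-2πi x·ξ} f(x) dx`. -/
def FT {n : ℕ} (f : E n → ℂ) (ξ : E n) : ℂ :=
  ∫ x, Complex.exp (((-2 * π * ⟪x, ξ⟫ : ℝ) : ℂ) * Complex.I) * f x

/-- The Sobolev norm `‖f‖_{H^s} = (∫ (1+|ξ|²)^s |f̂(ξ)|² dξ)^{1/2}`. -/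
def sobolevNorm {n : ℕ} (f : E n → ℂ) (s : ℝ) : ℝ :=
  (∫ ξ : E n, (1 + ‖ξ‖ ^ 2) ^ s * ‖FT f ξ‖ ^ 2) ^ (1/2 : ℝ)

/-- The half-wave propagator `e^{it√(-Δ)}f(x) = ∫ e^{2πi(x·ξ+t|ξ|)} f̂(ξ) dξ`. -/
def halfWave {n : ℕ} (f : E n → ℂ) (t : ℝ) (x : E n) : ℂ :=
  ∫ ξ : E n, Complex.exp (((2 * π * (⟪x, ξ⟫ + t * ‖ξ‖) : ℝ) : ℂ) * Complex.I) * FT f ξ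

/-- The character `e^{2πi x·ξ}`. -/
def planeWave {n : ℕ} (x ξ : E n) : ℂ := Complex.exp (((2 * π * ⟪x, ξ⟫ : ℝ) : ℂ) * Complex.I)

lemma norm_planeWave {n : ℕ} (x ξ : E n) : ‖planeWave x ξ‖ = 1 :=
  Complex.norm_exp_ofReal_mul_I _

lemma conj_planeWave {n : ℕ} (x ξ : E n) :
    (starRingEnd ℂ) (planeWave x ξ) = planeWave (-x) ξ := by
  rw [planeWave, planeWave, ← Complex.exp_conj, map_mul, Complex.conj_ofReal, Complex.conj_I,
    inner_neg_left]
  congr 1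
  push_cast
  ring

lemma planeWave_mul_neg {n : ℕ} (x y ξ : E n) :
    planeWave x ξ * planeWave (-y) ξ = planeWave (x - y) ξ := by
  rw [planeWave, planeWave, planeWave, ← Complex.exp_add, inner_sub_left, inner_neg_left]
  congr 1
  push_cast
  ring

lemma continuous_planeWave {n : ℕ} :
    Continuous (fun z : E n × E n => planeWave z.1 z.2) := by
  unfold planeWave
  fun_prop

@[fun_prop]
lemma Continuous.planeWave {X : Type*} [TopologicalSpace X] {n : ℕ} {f g : X → E n}
    (hf : Continuous f) (hg : Continuous g) : Continuous (fun x => planeWave (f x) (g x)) :=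
  continuous_planeWave.comp (hf.prodMk hg)

lemma measure_ball_le_frostman {n : ℕ} (μ : Measure (E n)) (α : ℝ) (x : E n) {r : ℝ}
    (hr : 0 < r) : μ (ball x r) ≤ ENNReal.ofReal (r ^ α) * frostman μ α := by
  have h : μ (ball x r) / ENNReal.ofReal (r ^ α) ≤ frostman μ α :=
    le_iSup_of_le x (le_iSup_of_le r (le_iSup_of_le hr le_rfl))
  rwa [ENNReal.div_le_iff' (by simpa using Real.rpow_pos_of_pos hr α) ENNReal.ofReal_ne_top] at h

lemma lintegral_gaussian_le_frostman (n : ℕ) {α : ℝ} (hα : α ≤ n) :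
    ∃ C : ℝ≥0∞, C ≠ ⊤ ∧ ∀ (μ : Measure (E n)) (x : E n) (a : ℝ), 0 < a →
      ∫⁻ y, ENNReal.ofReal (Real.exp (-a * ‖x - y‖ ^ 2)) ∂μ ≤
        C * ENNReal.ofReal (a ^ (-α / 2)) * frostman μ α := by
  refine ⟨∑' k : ℕ, ENNReal.ofReal (Real.exp (-(k : ℝ) ^ 2) * ((k : ℝ) + 1) ^ α), ?_, ?_⟩
  · refine (Summable.tsum_ofReal_ne_top ?_)
    have h1 : Summable (fun k : ℕ => (((k + 1 : ℕ) : ℝ)) ^ n * Real.exp (-1 * ((k + 1 : ℕ) : ℝ))) :=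
      (summable_nat_add_iff 1).2 (Real.summable_pow_mul_exp_neg_nat_mul n one_pos)
    refine Summable.of_nonneg_of_le (fun k => by positivity) (fun k => ?_)
      (h1.mul_left (Real.exp 1))
    have hk : (k : ℝ) ≤ (k : ℝ) ^ 2 := by exact_mod_cast Nat.le_self_pow two_ne_zero k
    have h2 : Real.exp (-(k : ℝ) ^ 2) ≤ Real.exp 1 * Real.exp (-1 * ((k + 1 : ℕ) : ℝ)) := by
      rw [← Real.exp_add]
      gcongr
      push_cast
      linarith
    have h3 : ((k : ℝ) + 1) ^ α ≤ (((k + 1 : ℕ) : ℝ)) ^ n := by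
      rw [← Real.rpow_natCast]
      push_cast
      exact Real.rpow_le_rpow_of_exponent_le (by linarith [k.cast_nonneg (α := ℝ)]) hα
    calc _ ≤ (Real.exp 1 * Real.exp (-1 * ((k + 1 : ℕ) : ℝ))) * (((k + 1 : ℕ) : ℝ)) ^ n := by
          gcongr
      _ = _ := by ring
  · intro μ x a ha
    have hs : 0 < √a := Real.sqrt_pos.2 ha
    have hpt (y : E n) : ENNReal.ofReal (Real.exp (-a * ‖x - y‖ ^ 2)) ≤
        ∑' k : ℕ, (ball x (((k : ℝ) + 1) / √a)).indicator
          (fun _ => ENNReal.ofReal (Real.exp (-(k : ℝ) ^ 2))) y := by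
      refine le_trans ?_ (ENNReal.le_tsum ⌊√a * ‖x - y‖⌋₊)
      have hy : y ∈ ball x (((⌊√a * ‖x - y‖⌋₊ : ℝ) + 1) / √a) := by
        rw [mem_ball', dist_eq_norm, lt_div_iff₀ hs, mul_comm]
        exact Nat.lt_floor_add_one _
      rw [Set.indicator_of_mem hy]
      gcongr
      have h1 : (⌊√a * ‖x - y‖⌋₊ : ℝ) ≤ √a * ‖x - y‖ := Nat.floor_le (by positivity)
      have h2 : a * ‖x - y‖ ^ 2 = (√a * ‖x - y‖) ^ 2 := by rw [mul_pow, Real.sq_sqrt ha.le]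
      rw [neg_mul, h2]
      gcongr
    calc _ ≤ ∫⁻ y, ∑' k : ℕ, (ball x (((k : ℝ) + 1) / √a)).indicator
          (fun _ => ENNReal.ofReal (Real.exp (-(k : ℝ) ^ 2))) y ∂μ := lintegral_mono hpt
      _ = ∑' k : ℕ, ENNReal.ofReal (Real.exp (-(k : ℝ) ^ 2)) *
            μ (ball x (((k : ℝ) + 1) / √a)) := by
          rw [lintegral_tsum (fun k => (measurable_const.indicator measurableSet_ball).aemeasurable)]
          congr with k
          rw [lintegral_indicator_const measurableSet_ball]
      _ ≤ ∑' k : ℕ, ENNReal.ofReal (Real.exp (-(k : ℝ) ^ 2) * ((k : ℝ) + 1) ^ α) *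
            (ENNReal.ofReal (a ^ (-α / 2)) * frostman μ α) := by
          refine ENNReal.tsum_le_tsum fun k => ?_
          have hr : 0 < ((k : ℝ) + 1) / √a := by positivity
          refine (mul_le_mul_right (measure_ball_le_frostman μ α x hr) _).trans ?_
          have h1 : (((k : ℝ) + 1) / √a) ^ α = ((k : ℝ) + 1) ^ α * a ^ (-α / 2) := by
            rw [Real.div_rpow (by positivity) hs.le, Real.sqrt_eq_rpow, ← Real.rpow_mul ha.le,
              div_eq_mul_inv, ← Real.rpow_neg ha.le]
            congr 2
            ring
          rw [h1, ← mul_assoc, ← ENNReal.ofReal_mul (Real.exp_pos _).le, ← mul_assoc, ← mul_assoc,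
            ← ENNReal.ofReal_mul (mul_nonneg (Real.exp_pos _).le (by positivity))]
      _ = _ := by rw [ENNReal.tsum_mul_right, mul_assoc]

lemma integrable_gaussian (n : ℕ) {a : ℝ} (ha : 0 < a) :
    Integrable (fun ξ : E n => Real.exp (-a * ‖ξ‖ ^ 2)) := by
  have h := (GaussianFourier.integrable_cexp_neg_mul_sq_norm_add (V := E n) (b := (a : ℂ))
    (by simpa using ha) 0 0).norm
  refine h.congr (ae_of_all _ fun ξ => ?_)
  simp [Complex.norm_exp, ← Complex.ofReal_pow]

lemma integral_planeWave_mul_gaussian (n : ℕ) {a : ℝ} (ha : 0 < a) (w : E n) :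
    ∫ ξ : E n, planeWave w ξ * (Real.exp (-a * ‖ξ‖ ^ 2) : ℂ) =
      (((π / a) ^ ((n : ℝ) / 2) * Real.exp (-(π ^ 2 / a) * ‖w‖ ^ 2) : ℝ) : ℂ) := by
  have h := GaussianFourier.integral_cexp_neg_mul_sq_norm_add (V := E n) (b := (a : ℂ))
    (by simpa using ha) (2 * π * Complex.I) w
  convert h using 1
  · congr with ξ
    rw [planeWave, Complex.ofReal_exp, ← Complex.exp_add]
    congr 1
    push_cast
    ring
  · rw [Complex.ofReal_mul, Complex.ofReal_exp, Complex.ofReal_cpow (by positivity)]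
    have ha' : (a : ℂ) ≠ 0 := by exact_mod_cast ha.ne'
    congr 1
    · simp
    · congr 1
      push_cast
      rw [mul_pow, mul_pow, Complex.I_sq]
      field_simp
      ring

/-- The Fourier-Stieltjes transform of the measure `h μ`. -/
def measureFT {n : ℕ} (μ : Measure (E n)) (h : E n → ℂ) (ξ : E n) : ℂ :=
  ∫ x, planeWave (-x) ξ * h x ∂μ

lemma integrable_of_bounded {X : Type*} [MeasurableSpace X] {μ : Measure X} [IsFiniteMeasure μ]
    {h : X → ℂ} (hm : AEStronglyMeasurable h μ) {M : ℝ} (hM : ∀ x, ‖h x‖ ≤ M) : Integrable h μ :=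
  Integrable.of_bound hm M (ae_of_all _ hM)

lemma continuous_measureFT {n : ℕ} (μ : Measure (E n)) {h : E n → ℂ} (hi : Integrable h μ) :
    Continuous (measureFT μ h) := by
  refine continuous_of_dominated (bound := fun x => ‖h x‖) (fun ξ => ?_) (fun ξ => ?_) hi.norm ?_
  · exact (Continuous.aestronglyMeasurable (by fun_prop)).mul hi.1
  · exact ae_of_all _ fun x => by simp [norm_planeWave]
  · exact ae_of_all _ fun x => by fun_prop

lemma norm_measureFT_le {n : ℕ} (μ : Measure (E n)) (h : E n → ℂ) (ξ : E n) :
    ‖measureFT μ h ξ‖ ≤ ∫ x, ‖h x‖ ∂μ := by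
  refine (norm_integral_le_integral_norm _).trans_eq ?_
  simp [norm_planeWave]

lemma ofReal_norm_measureFT_sq {n : ℕ} (μ : Measure (E n)) [SFinite μ] (h : E n → ℂ) (ξ : E n) :
    ((‖measureFT μ h ξ‖ ^ 2 : ℝ) : ℂ) =
      ∫ z, planeWave (z.2 - z.1) ξ * (h z.1 * (starRingEnd ℂ) (h z.2)) ∂(μ.prod μ) := by
  rw [Complex.ofReal_pow, ← Complex.mul_conj', measureFT, ← integral_conj, ← integral_prod_mul]
  congr with z
  rw [map_mul, conj_planeWave, neg_neg, sub_eq_add_neg, ← sub_neg_eq_add z.2, sub_neg_eq_add,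
    ← sub_eq_add_neg, ← planeWave_mul_neg]
  ring

lemma integral_norm_measureFT_sq_mul_gaussian {n : ℕ} (μ : Measure (E n)) [IsFiniteMeasure μ]
    {h : E n → ℂ} (hi : Integrable h μ) {a : ℝ} (ha : 0 < a) :
    ((∫ ξ, ‖measureFT μ h ξ‖ ^ 2 * Real.exp (-a * ‖ξ‖ ^ 2) : ℝ) : ℂ) =
      ∫ z, ((π / a) ^ ((n : ℝ) / 2) * Real.exp (-(π ^ 2 / a) * ‖z.2 - z.1‖ ^ 2) : ℝ) *
        (h z.1 * (starRingEnd ℂ) (h z.2)) ∂(μ.prod μ) := by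
  have hh : Integrable (fun z : E n × E n => h z.1 * (starRingEnd ℂ) (h z.2)) (μ.prod μ) :=
    hi.mul_prod (Complex.conjLIE.integrable_comp_iff.2 hi)
  have hg : Integrable (fun ξ : E n => (Real.exp (-a * ‖ξ‖ ^ 2) : ℂ)) :=
    (integrable_gaussian n ha).ofReal
  have hphase : AEStronglyMeasurable
      (fun p : E n × (E n × E n) => planeWave (p.2.2 - p.2.1) p.1) (volume.prod (μ.prod μ)) :=
    Continuous.aestronglyMeasurable (by fun_prop)
  have hprod := (hg.mul_prod hh).bdd_mul hphase (c := 1)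
    (ae_of_all _ fun p => (norm_planeWave _ _).le)
  have hswap := integral_integral_swap (f := fun (ξ : E n) (z : E n × E n) =>
    planeWave (z.2 - z.1) ξ * ((Real.exp (-a * ‖ξ‖ ^ 2) : ℂ) *
      (h z.1 * (starRingEnd ℂ) (h z.2)))) hprod
  rw [← integral_complex_ofReal]
  refine Eq.trans ?_ (hswap.trans ?_)
  · congr with ξ
    rw [Complex.ofReal_mul, ofReal_norm_measureFT_sq, mul_comm, ← integral_const_mul]
    congr with z
    ring
  · congr with z
    rw [← integral_planeWave_mul_gaussian n ha, ← integral_mul_const]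
    congr with ξ
    ring

lemma lintegral_norm_measureFT_sq_mul_gaussian_le {n : ℕ} (μ : Measure (E n)) [IsFiniteMeasure μ]
    {h : E n → ℂ} (hi : Integrable h μ) {a : ℝ} (ha : 0 < a) :
    ∫⁻ ξ, ‖measureFT μ h ξ‖ₑ ^ 2 * ENNReal.ofReal (Real.exp (-a * ‖ξ‖ ^ 2)) ≤
      ENNReal.ofReal ((π / a) ^ ((n : ℝ) / 2)) *
        ∫⁻ z, ENNReal.ofReal (Real.exp (-(π ^ 2 / a) * ‖z.2 - z.1‖ ^ 2)) *
          (‖h z.1‖ₑ * ‖h z.2‖ₑ) ∂(μ.prod μ) := by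
  have hint : Integrable (fun ξ => ‖measureFT μ h ξ‖ ^ 2 * Real.exp (-a * ‖ξ‖ ^ 2)) := by
    refine (integrable_gaussian n ha).bdd_mul (c := (∫ x, ‖h x‖ ∂μ) ^ 2)
      (((continuous_measureFT μ hi).norm.pow 2).aestronglyMeasurable) (ae_of_all _ fun ξ => ?_)
    rw [norm_pow, norm_norm]
    gcongr
    exact norm_measureFT_le μ h ξ
  have h0 : 0 ≤ ∫ ξ, ‖measureFT μ h ξ‖ ^ 2 * Real.exp (-a * ‖ξ‖ ^ 2) :=
    integral_nonneg fun ξ => by positivity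
  calc _ = ENNReal.ofReal (∫ ξ, ‖measureFT μ h ξ‖ ^ 2 * Real.exp (-a * ‖ξ‖ ^ 2)) := by
        rw [ofReal_integral_eq_lintegral_ofReal hint (ae_of_all _ fun ξ => by positivity)]
        congr with ξ
        rw [ENNReal.ofReal_mul (by positivity), ENNReal.ofReal_pow (norm_nonneg _), ofReal_norm]
    _ = ‖((∫ ξ, ‖measureFT μ h ξ‖ ^ 2 * Real.exp (-a * ‖ξ‖ ^ 2) : ℝ) : ℂ)‖ₑ := by
        rw [← ofReal_norm, Complex.norm_real, Real.norm_of_nonneg h0]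
    _ ≤ ∫⁻ z, ‖((π / a) ^ ((n : ℝ) / 2) * Real.exp (-(π ^ 2 / a) * ‖z.2 - z.1‖ ^ 2) : ℝ) *
        (h z.1 * (starRingEnd ℂ) (h z.2))‖ₑ ∂(μ.prod μ) := by
        rw [integral_norm_measureFT_sq_mul_gaussian μ hi ha]
        exact enorm_integral_le_lintegral_enorm _
    _ = _ := by
        rw [← lintegral_const_mul' _ _ ENNReal.ofReal_ne_top]
        congr with z
        rw [enorm_mul, enorm_mul, ← ofReal_norm ((_ : ℝ) : ℂ), Complex.norm_real,
          Real.norm_of_nonneg (by positivity), ENNReal.ofReal_mul (by positivity), mul_assoc,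
          RCLike.enorm_conj]

lemma lintegral_kernel_mul_le {X : Type*} [MeasurableSpace X] (μ : Measure X) [SFinite μ]
    {k : X → X → ℝ≥0∞} (hk : Measurable (Function.uncurry k)) (hsymm : ∀ x y, k x y = k y x)
    {A : ℝ≥0∞} (hA : ∀ x, ∫⁻ y, k x y ∂μ ≤ A) {f : X → ℝ≥0∞} (hf : Measurable f) :
    ∫⁻ z, k z.1 z.2 * (f z.1 * f z.2) ∂(μ.prod μ) ≤ A * ∫⁻ x, f x ^ 2 ∂μ := by
  have h2 (a b : ℝ≥0∞) : 2 * (a * b) ≤ a ^ 2 + b ^ 2 := by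
    rcases eq_or_ne a ⊤ with rfl | ha
    · simp
    rcases eq_or_ne b ⊤ with rfl | hb
    · simp
    lift a to NNReal using ha
    lift b to NNReal using hb
    norm_cast
    rw [← mul_assoc]
    exact two_mul_le_add_sq a b
  have hk' : Measurable fun z : X × X => k z.1 z.2 := hk
  have e1 : ∫⁻ z, k z.1 z.2 * f z.1 ^ 2 ∂(μ.prod μ) ≤ A * ∫⁻ x, f x ^ 2 ∂μ := by
    rw [lintegral_prod _ (by fun_prop), ← lintegral_const_mul _ (by fun_prop)]
    refine lintegral_mono fun x => ?_
    dsimp only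
    rw [lintegral_mul_const _ (by fun_prop)]
    gcongr
    exact hA x
  have e2 : ∫⁻ z, k z.1 z.2 * f z.2 ^ 2 ∂(μ.prod μ) ≤ A * ∫⁻ x, f x ^ 2 ∂μ := by
    rw [lintegral_prod_symm _ (by fun_prop), ← lintegral_const_mul _ (by fun_prop)]
    refine lintegral_mono fun x => ?_
    dsimp only
    rw [lintegral_mul_const _ (by fun_prop)]
    gcongr
    simp_rw [fun y => hsymm y x]
    exact hA x
  have h3 : 2 * ∫⁻ z, k z.1 z.2 * (f z.1 * f z.2) ∂(μ.prod μ) ≤ 2 * (A * ∫⁻ x, f x ^ 2 ∂μ) := by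
    calc _ = ∫⁻ z, k z.1 z.2 * (2 * (f z.1 * f z.2)) ∂(μ.prod μ) := by
          rw [← lintegral_const_mul _ (by fun_prop)]
          congr with z
          ring
      _ ≤ ∫⁻ z, (k z.1 z.2 * f z.1 ^ 2 + k z.1 z.2 * f z.2 ^ 2) ∂(μ.prod μ) := by
          refine lintegral_mono fun z => ?_
          dsimp only
          rw [← mul_add]
          gcongr
          exact h2 _ _
      _ ≤ _ := by
          rw [lintegral_add_left (by fun_prop), two_mul]
          gcongr
  exact (ENNReal.mul_le_mul_iff_right two_ne_zero ENNReal.ofNat_ne_top).1 h3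

lemma lintegral_measureFT_gaussian_le_frostman (n : ℕ) {α : ℝ} (hα : α ≤ n) :
    ∃ C : ℝ≥0∞, C ≠ ⊤ ∧ ∀ (μ : Measure (E n)) (_ : IsFiniteMeasure μ) (h : E n → ℂ),
      Measurable h → Integrable h μ → ∀ a : ℝ, 0 < a →
        ∫⁻ ξ, ‖measureFT μ h ξ‖ₑ ^ 2 * ENNReal.ofReal (Real.exp (-a * ‖ξ‖ ^ 2)) ≤
          C * ENNReal.ofReal (a ^ ((α - n) / 2)) * (frostman μ α * ∫⁻ x, ‖h x‖ₑ ^ 2 ∂μ) := by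
  obtain ⟨C, hC, hC'⟩ := lintegral_gaussian_le_frostman n hα
  refine ⟨C * ENNReal.ofReal (π ^ ((n : ℝ) / 2) * (π ^ 2) ^ (-α / 2)), by finiteness, ?_⟩
  intro μ _ h hm hi a ha
  refine (lintegral_norm_measureFT_sq_mul_gaussian_le μ hi ha).trans ?_
  have hk := lintegral_kernel_mul_le μ
    (k := fun x y : E n => ENNReal.ofReal (Real.exp (-(π ^ 2 / a) * ‖y - x‖ ^ 2)))
    (by unfold Function.uncurry; fun_prop) (fun x y => by rw [norm_sub_rev])
    (A := C * ENNReal.ofReal ((π ^ 2 / a) ^ (-α / 2)) * frostman μ α)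
    (fun x => by
      simp_rw [norm_sub_rev _ x]
      exact hC' μ x (π ^ 2 / a) (by positivity)) (f := fun x => ‖h x‖ₑ) (by fun_prop)
  refine (mul_le_mul_right hk _).trans_eq ?_
  have hpow : (π / a) ^ ((n : ℝ) / 2) * (π ^ 2 / a) ^ (-α / 2) =
      π ^ ((n : ℝ) / 2) * (π ^ 2) ^ (-α / 2) * a ^ ((α - n) / 2) := by
    rw [Real.div_rpow pi_pos.le ha.le, Real.div_rpow (by positivity) ha.le,
      show (α - n) / 2 = -((n : ℝ) / 2) + -(-α / 2) by ring, Real.rpow_add ha,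
      Real.rpow_neg ha.le, Real.rpow_neg ha.le]
    ring
  calc _ = C * (ENNReal.ofReal ((π / a) ^ ((n : ℝ) / 2)) *
        ENNReal.ofReal ((π ^ 2 / a) ^ (-α / 2))) * (frostman μ α * ∫⁻ x, ‖h x‖ₑ ^ 2 ∂μ) := by ring
    _ = _ := by
      rw [← ENNReal.ofReal_mul (by positivity), hpow, ENNReal.ofReal_mul (by positivity)]
      ring

lemma ofReal_rpow_neg_mul_Gamma {s r : ℝ} (hs : 0 < s) (hr : 0 < r) :
    ENNReal.ofReal (r ^ (-s)) * ENNReal.ofReal (Real.Gamma s) =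
      ∫⁻ a in Set.Ioi (0 : ℝ), ENNReal.ofReal (a ^ (s - 1) * Real.exp (-(r * a))) := by
  have h := Real.integral_rpow_mul_exp_neg_mul_Ioi hs hr
  have hne : (1 / r) ^ s * Real.Gamma s ≠ 0 :=
    (mul_pos (by positivity) (Real.Gamma_pos_of_pos hs)).ne'
  have hint : IntegrableOn (fun a : ℝ => a ^ (s - 1) * Real.exp (-(r * a))) (Set.Ioi 0) := by
    by_contra hni
    exact hne (h ▸ integral_undef hni)
  rw [← ofReal_integral_eq_lintegral_ofReal hint, h, ENNReal.ofReal_mul (by positivity),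
    Real.rpow_neg hr.le, one_div, Real.inv_rpow hr.le]
  filter_upwards [ae_restrict_mem measurableSet_Ioi] with a ha
  have : (0 : ℝ) < a := ha
  positivity

lemma lintegral_measureFT_bessel_le_frostman (n : ℕ) {α s : ℝ} (hα : α ≤ n)
    (hs : ((n : ℝ) - α) / 2 < s) :
    ∃ C : ℝ≥0∞, C ≠ ⊤ ∧ ∀ (μ : Measure (E n)) (_ : IsFiniteMeasure μ) (h : E n → ℂ),
      Measurable h → Integrable h μ →
        ∫⁻ ξ, ‖measureFT μ h ξ‖ₑ ^ 2 * ENNReal.ofReal ((1 + ‖ξ‖ ^ 2) ^ (-s)) ≤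
          C * (frostman μ α * ∫⁻ x, ‖h x‖ₑ ^ 2 ∂μ) := by
  obtain ⟨C, hC, hC'⟩ := lintegral_measureFT_gaussian_le_frostman n hα
  have hs0 : 0 < s := by linarith
  have hG := Real.Gamma_pos_of_pos hs0
  set I : ℝ≥0∞ := ∫⁻ a in Set.Ioi (0 : ℝ),
    ENNReal.ofReal (Real.exp (-a) * a ^ (s - ((n : ℝ) - α) / 2 - 1)) with hI
  have hIfin : I ≠ ⊤ := by
    have := (Real.GammaIntegral_convergent (sub_pos.2 hs)).lintegral_lt_top
    exact this.ne
  refine ⟨C * I * (ENNReal.ofReal (Real.Gamma s))⁻¹,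
    ENNReal.mul_ne_top (ENNReal.mul_ne_top hC hIfin) (by simpa using hG), ?_⟩
  intro μ _ h hm hi
  have hmeas : Measurable (measureFT μ h) := (continuous_measureFT μ hi).measurable
  set Q := frostman μ α * ∫⁻ x, ‖h x‖ₑ ^ 2 ∂μ
  have key : (∫⁻ ξ, ‖measureFT μ h ξ‖ₑ ^ 2 * ENNReal.ofReal ((1 + ‖ξ‖ ^ 2) ^ (-s))) *
      ENNReal.ofReal (Real.Gamma s) ≤ C * I * Q := by
    calc _ = ∫⁻ ξ, ∫⁻ a in Set.Ioi (0 : ℝ), ‖measureFT μ h ξ‖ₑ ^ 2 *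
          ENNReal.ofReal (a ^ (s - 1) * Real.exp (-((1 + ‖ξ‖ ^ 2) * a))) := by
          rw [← lintegral_mul_const' _ _ ENNReal.ofReal_ne_top]
          congr with ξ
          rw [mul_assoc, ofReal_rpow_neg_mul_Gamma hs0 (by positivity),
            lintegral_const_mul _ (by fun_prop)]
      _ = ∫⁻ a in Set.Ioi (0 : ℝ), ∫⁻ ξ, ‖measureFT μ h ξ‖ₑ ^ 2 *
          ENNReal.ofReal (a ^ (s - 1) * Real.exp (-((1 + ‖ξ‖ ^ 2) * a))) :=
          lintegral_lintegral_swap (by unfold Function.uncurry; fun_prop)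
      _ ≤ ∫⁻ a in Set.Ioi (0 : ℝ), C *
          ENNReal.ofReal (Real.exp (-a) * a ^ (s - ((n : ℝ) - α) / 2 - 1)) * Q := by
          refine setLIntegral_mono (by fun_prop) fun a ha => ?_
          have ha : 0 < a := ha
          calc _ = ∫⁻ ξ, ENNReal.ofReal (a ^ (s - 1) * Real.exp (-a)) *
                (‖measureFT μ h ξ‖ₑ ^ 2 * ENNReal.ofReal (Real.exp (-a * ‖ξ‖ ^ 2))) := by
                congr with ξ
                rw [mul_left_comm, ← ENNReal.ofReal_mul (by positivity), mul_assoc (a ^ (s - 1)),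
                  ← Real.exp_add]
                ring_nf
            _ ≤ ENNReal.ofReal (a ^ (s - 1) * Real.exp (-a)) *
                (C * ENNReal.ofReal (a ^ ((α - n) / 2)) * Q) := by
                rw [lintegral_const_mul' _ _ ENNReal.ofReal_ne_top]
                gcongr
                exact hC' μ inferInstance h hm hi a ha
            _ = C * (ENNReal.ofReal (a ^ (s - 1) * Real.exp (-a)) *
                ENNReal.ofReal (a ^ ((α - n) / 2))) * Q := by ring
            _ = _ := by
                rw [← ENNReal.ofReal_mul (by positivity), mul_right_comm (a ^ (s - 1)),
                  ← Real.rpow_add ha,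
                  mul_comm (Real.exp (-a))]
                ring_nf
      _ = C * I * Q := by
          rw [lintegral_mul_const _ (by fun_prop), lintegral_const_mul _ (by fun_prop)]
  rw [mul_right_comm, ← div_eq_mul_inv,
    ENNReal.le_div_iff_mul_le (Or.inl (by simpa using hG)) (Or.inl ENNReal.ofReal_ne_top)]
  exact key

lemma continuous_integral_planeWave {n : ℕ} {g : E n → ℂ} (hg : Integrable g) :
    Continuous fun x : E n => ∫ ξ, planeWave x ξ * g ξ := by
  refine continuous_of_dominated (bound := fun x => ‖g x‖) (fun ξ => ?_) (fun ξ => ?_) hg.norm ?_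
  · exact (Continuous.aestronglyMeasurable (by fun_prop)).mul hg.1
  · exact ae_of_all _ fun x => by simp [norm_planeWave]
  · exact ae_of_all _ fun x => by fun_prop

lemma norm_integral_planeWave_le {n : ℕ} (g : E n → ℂ) (x : E n) :
    ‖∫ ξ, planeWave x ξ * g ξ‖ ≤ ∫ ξ, ‖g ξ‖ := by
  refine (norm_integral_le_integral_norm _).trans_eq ?_
  simp [norm_planeWave]

lemma integral_mul_conj_eq_integral_measureFT {n : ℕ} (μ : Measure (E n)) [SFinite μ]
    {g h : E n → ℂ} (hg : Integrable g) (hh : Integrable h μ) :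
    ∫ x, (∫ ξ, planeWave x ξ * g ξ) * (starRingEnd ℂ) (h x) ∂μ =
      ∫ ξ, g ξ * (starRingEnd ℂ) (measureFT μ h ξ) := by
  have hprod := ((Complex.conjLIE.integrable_comp_iff.2 hh).mul_prod hg).bdd_mul
    (f := fun p : E n × E n => planeWave p.1 p.2) (c := 1)
    (Continuous.aestronglyMeasurable (by fun_prop)) (ae_of_all _ fun p => (norm_planeWave _ _).le)
  have hswap := integral_integral_swap (f := fun x ξ : E n =>
    planeWave x ξ * ((starRingEnd ℂ) (h x) * g ξ)) hprod
  refine Eq.trans ?_ (hswap.trans ?_)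
  · congr with x
    rw [← integral_mul_const]
    congr with ξ
    ring
  · congr with ξ
    rw [measureFT, ← integral_conj, ← integral_const_mul]
    congr with x
    rw [map_mul, conj_planeWave, neg_neg]
    ring

lemma lintegral_enorm_mul_le_weighted {n : ℕ} (s : ℝ) {g H : E n → ℂ} (hg : AEMeasurable g)
    (hH : AEMeasurable H) :
    ∫⁻ ξ, ‖g ξ‖ₑ * ‖H ξ‖ₑ ≤
      (∫⁻ ξ, ‖g ξ‖ₑ ^ 2 * ENNReal.ofReal ((1 + ‖ξ‖ ^ 2) ^ s)) ^ (1 / 2 : ℝ) *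
      (∫⁻ ξ, ‖H ξ‖ₑ ^ 2 * ENNReal.ofReal ((1 + ‖ξ‖ ^ 2) ^ (-s))) ^ (1 / 2 : ℝ) := by
  refine le_trans (le_of_eq ?_) (ENNReal.lintegral_mul_norm_pow_le (by fun_prop) (by fun_prop)
    (by norm_num) (by norm_num) (by norm_num))
  congr with ξ
  have hw : ENNReal.ofReal ((1 + ‖ξ‖ ^ 2) ^ s) * ENNReal.ofReal ((1 + ‖ξ‖ ^ 2) ^ (-s)) = 1 := by
    rw [← ENNReal.ofReal_mul (by positivity), ← Real.rpow_add (by positivity)]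
    simp
  rw [← ENNReal.mul_rpow_of_nonneg _ _ (by norm_num), mul_mul_mul_comm, hw, mul_one, ← mul_pow,
    ← ENNReal.rpow_natCast, ← ENNReal.rpow_mul]
  norm_num

/-- The `L²` trace inequality with respect to a fractal measure. -/
lemma lintegral_planeWave_sq_le_frostman (n : ℕ) {α s : ℝ} (hα : α ≤ n)
    (hs : ((n : ℝ) - α) / 2 < s) :
    ∃ C : ℝ≥0∞, C ≠ ⊤ ∧ ∀ (μ : Measure (E n)) (_ : IsFiniteMeasure μ) (g : E n → ℂ),
      Integrable g →
        ∫⁻ x, ‖∫ ξ, planeWave x ξ * g ξ‖ₑ ^ 2 ∂μ ≤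
          C * frostman μ α * ∫⁻ ξ, ‖g ξ‖ₑ ^ 2 * ENNReal.ofReal ((1 + ‖ξ‖ ^ 2) ^ s) := by
  obtain ⟨C, hC, hC'⟩ := lintegral_measureFT_bessel_le_frostman n hα hs
  refine ⟨C, hC, fun μ _ g hg => ?_⟩
  set u : E n → ℂ := fun x => ∫ ξ, planeWave x ξ * g ξ with hu
  have huc : Continuous u := continuous_integral_planeWave hg
  have hub (x : E n) : ‖u x‖ ≤ ∫ ξ, ‖g ξ‖ := norm_integral_planeWave_le g x
  have hui : Integrable u μ := integrable_of_bounded huc.aestronglyMeasurable hub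
  set S := ∫⁻ ξ, ‖g ξ‖ₑ ^ 2 * ENNReal.ofReal ((1 + ‖ξ‖ ^ 2) ^ s)
  set U := ∫⁻ x, ‖u x‖ₑ ^ 2 ∂μ with hU
  have hUeq : U = ENNReal.ofReal (∫ x, ‖u x‖ ^ 2 ∂μ) := by
    have hi : Integrable (fun x => ‖u x‖ ^ 2) μ := by
      refine Integrable.of_bound (huc.norm.pow 2).aestronglyMeasurable ((∫ ξ, ‖g ξ‖) ^ 2)
        (ae_of_all _ fun x => ?_)
      rw [norm_pow, norm_norm]
      gcongr
      exact hub x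
    rw [ofReal_integral_eq_lintegral_ofReal hi (ae_of_all _ fun x => by positivity)]
    refine lintegral_congr fun x => ?_
    rw [ENNReal.ofReal_pow (norm_nonneg _), ofReal_norm]
  have hUtop : U ≠ ⊤ := hUeq ▸ ENNReal.ofReal_ne_top
  have h1 : U ≤ ∫⁻ ξ, ‖g ξ‖ₑ * ‖measureFT μ u ξ‖ₑ := by
    calc U = ‖((∫ x, ‖u x‖ ^ 2 ∂μ : ℝ) : ℂ)‖ₑ := by
          rw [hUeq, ← ofReal_norm, Complex.norm_real,
            Real.norm_of_nonneg (integral_nonneg fun x => by positivity)]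
      _ = ‖∫ ξ, g ξ * (starRingEnd ℂ) (measureFT μ u ξ)‖ₑ := by
          rw [← integral_mul_conj_eq_integral_measureFT μ hg hui, ← integral_complex_ofReal]
          refine congrArg (fun z : ℂ => ‖z‖ₑ) (integral_congr_ae (ae_of_all _ fun x => ?_))
          dsimp only
          rw [Complex.ofReal_pow, ← Complex.mul_conj']
      _ ≤ ∫⁻ ξ, ‖g ξ * (starRingEnd ℂ) (measureFT μ u ξ)‖ₑ := enorm_integral_le_lintegral_enorm _
      _ = _ := by simp_rw [enorm_mul, RCLike.enorm_conj]
  have h2 : U ≤ (S * (C * (frostman μ α * U))) ^ (1 / 2 : ℝ) := by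
    refine h1.trans ((lintegral_enorm_mul_le_weighted s hg.1.aemeasurable
      (continuous_measureFT μ hui).measurable.aemeasurable).trans ?_)
    rw [ENNReal.mul_rpow_of_nonneg _ _ (by norm_num)]
    gcongr
    exact hC' μ inferInstance u huc.measurable hui
  have h3 : U * U ≤ C * frostman μ α * S * U := by
    have h4 := ENNReal.rpow_le_rpow h2 (zero_le_two (α := ℝ))
    rw [← ENNReal.rpow_mul] at h4
    norm_num at h4
    calc U * U = U ^ 2 := (sq U).symm
      _ ≤ _ := h4
      _ = _ := by ring
  rcases eq_or_ne U 0 with h0 | h0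
  · rw [h0]
    exact zero_le
  · exact (ENNReal.mul_le_mul_iff_left h0 hUtop).1 h3

/-- The `Lᵖ` trace inequality for `1 ≤ p ≤ 2`, with respect to a fractal measure on the unit
ball. -/
lemma lintegral_planeWave_rpow_le_frostman (n : ℕ) {p α s : ℝ} (hp₁ : 1 ≤ p) (hp₂ : p ≤ 2)
    (hα : α ≤ n) (hs : ((n : ℝ) - α) / 2 < s) :
    ∃ C : ℝ≥0∞, C ≠ ⊤ ∧ ∀ (μ : Measure (E n)) (_ : IsFiniteMeasure μ),
      μ (ball (0 : E n) 1)ᶜ = 0 → ∀ g : E n → ℂ, Integrable g →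
        (∫⁻ x, ‖∫ ξ, planeWave x ξ * g ξ‖ₑ ^ p ∂μ) ^ (1 / p) ≤
          C * frostman μ α ^ (1 / p) *
            (∫⁻ ξ, ‖g ξ‖ₑ ^ 2 * ENNReal.ofReal ((1 + ‖ξ‖ ^ 2) ^ s)) ^ (1 / 2 : ℝ) := by
  obtain ⟨C, hC, hC'⟩ := lintegral_planeWave_sq_le_frostman n hα hs
  refine ⟨C ^ (1 / 2 : ℝ), ENNReal.rpow_ne_top_of_nonneg (by norm_num) hC, ?_⟩
  intro μ _ hsupp g hg
  have huc := continuous_integral_planeWave hg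
  have hp0 : 0 < p := by linarith
  have hexp : 0 ≤ 1 / p - 1 / 2 := sub_nonneg.2 (one_div_le_one_div_of_le hp0 hp₂)
  have hmass : μ Set.univ ≤ frostman μ α := by
    rw [← Set.union_compl_self (ball (0 : E n) 1)]
    refine (measure_union_le _ _).trans ?_
    rw [hsupp, add_zero]
    simpa using measure_ball_le_frostman μ α (0 : E n) one_pos
  have h := eLpNorm'_le_eLpNorm'_mul_rpow_measure_univ (μ := μ) hp0 hp₂ huc.aestronglyMeasurable
  simp only [eLpNorm'] at h
  have h2 := hC' μ inferInstance g hg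
  simp_rw [ENNReal.rpow_two] at h
  refine h.trans ?_
  set S := ∫⁻ ξ, ‖g ξ‖ₑ ^ 2 * ENNReal.ofReal ((1 + ‖ξ‖ ^ 2) ^ s)
  calc _ ≤ (C * frostman μ α * S) ^ (1 / 2 : ℝ) * frostman μ α ^ (1 / p - 1 / 2) := by
        gcongr
    _ = C ^ (1 / 2 : ℝ) * (frostman μ α ^ (1 / 2 : ℝ) * frostman μ α ^ (1 / p - 1 / 2)) *
        S ^ (1 / 2 : ℝ) := by
        rw [ENNReal.mul_rpow_of_nonneg _ _ (by norm_num), ENNReal.mul_rpow_of_nonneg _ _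
          (by norm_num)]
        ring
    _ = _ := by
        rw [← ENNReal.rpow_add_of_nonneg _ _ (by norm_num) hexp, add_sub_cancel]

lemma integrable_sobolev_weight_mul_sq {n : ℕ} (F : SchwartzMap (E n) ℂ) (s : ℝ) :
    Integrable fun ξ => (1 + ‖ξ‖ ^ 2) ^ s * ‖F ξ‖ ^ 2 := by
  obtain ⟨m, hm⟩ := exists_nat_ge s
  obtain ⟨M, hM⟩ := F.toBoundedContinuousFunction.bddAbove_range_norm_comp
  have hM' (ξ : E n) : ‖F ξ‖ ≤ M := hM ⟨ξ, rfl⟩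
  have hbound : Integrable fun ξ : E n =>
      2 ^ (m - 1) * M * (‖ξ‖ ^ 0 * ‖F ξ‖ + ‖ξ‖ ^ (2 * m) * ‖F ξ‖) :=
    ((F.integrable_pow_mul volume 0).add (F.integrable_pow_mul volume (2 * m))).const_mul _
  refine hbound.mono' (Continuous.aestronglyMeasurable ?_) (ae_of_all _ fun ξ => ?_)
  · have hF := F.continuous
    exact (Continuous.rpow_const (by fun_prop) fun ξ => Or.inl (by positivity)).mul (by fun_prop)
  · rw [Real.norm_of_nonneg (by positivity)]
    have h1 : (1 + ‖ξ‖ ^ 2) ^ s ≤ 2 ^ (m - 1) * (1 + ‖ξ‖ ^ (2 * m)) := by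
      calc _ ≤ (1 + ‖ξ‖ ^ 2) ^ (m : ℝ) :=
            Real.rpow_le_rpow_of_exponent_le (by nlinarith [sq_nonneg ‖ξ‖]) hm
        _ ≤ 2 ^ (m - 1) * (1 ^ m + (‖ξ‖ ^ 2) ^ m) := by
            rw [Real.rpow_natCast]
            exact add_pow_le zero_le_one (by positivity) m
        _ = _ := by rw [one_pow, pow_mul]
    calc _ ≤ 2 ^ (m - 1) * (1 + ‖ξ‖ ^ (2 * m)) * (M * ‖F ξ‖) := by
          rw [sq ‖F ξ‖]
          gcongr
          exact hM' ξ
      _ = _ := by ring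

lemma FT_eq_fourier {n : ℕ} (f : SchwartzMap (E n) ℂ) :
    FT (⇑f) = ⇑(FourierTransform.fourier f : SchwartzMap (E n) ℂ) := by
  ext ξ
  rw [SchwartzMap.fourier_coe, Real.fourier_eq', FT]
  rfl

lemma halfWave_eq_integral_planeWave {n : ℕ} (f : E n → ℂ) (t : ℝ) (x : E n) :
    halfWave f t x = ∫ ξ, planeWave x ξ *
      (Complex.exp (((2 * π * (t * ‖ξ‖) : ℝ) : ℂ) * Complex.I) * FT f ξ) := by
  rw [halfWave]
  congr with ξ
  rw [planeWave, ← mul_assoc, ← Complex.exp_add]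
  congr 2
  push_cast
  ring

/-- the fixed-time estimate for the half-wave propagator with respect to
fractal measures, with `s > (n-α)/2`. -/
theorem fixed_time_estimate (n : ℕ) (hn : 1 ≤ n) (p α s : ℝ)
    (hp₁ : 1 ≤ p) (hp₂ : p ≤ 2) (hα₀ : 0 < α) (hα₁ : α ≤ n) (hs : ((n : ℝ) - α) / 2 < s) :
    ∃ C : ℝ, 0 < C ∧
      ∀ (μ : Measure (E n)), IsFiniteMeasure μ →
        μ (Metric.ball (0 : E n) 1)ᶜ = 0 → frostman μ α < ⊤ →
        ∀ (f : SchwartzMap (E n) ℂ) (t : ℝ),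
          (∫ x, ‖halfWave (⇑f) t x‖ ^ p ∂μ) ^ (1/p) ≤
            C * (frostman μ α).toReal ^ (1/p) * sobolevNorm (⇑f) s := by
  obtain ⟨C, hC, hC'⟩ := lintegral_planeWave_rpow_le_frostman n hp₁ hp₂ hα₁ hs
  refine ⟨C.toReal + 1, by positivity, ?_⟩
  intro μ _ hsupp hfro f t
  have hp0 : 0 < p := by linarith
  set F : SchwartzMap (E n) ℂ := FourierTransform.fourier f with hF
  have hFT : FT (⇑f) = ⇑F := FT_eq_fourier f
  set g : E n → ℂ := fun ξ => Complex.exp (((2 * π * (t * ‖ξ‖) : ℝ) : ℂ) * Complex.I) * FT f ξ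
    with hg
  have hgi : Integrable g := by
    rw [hg, hFT]
    exact F.integrable.bdd_mul (c := 1) (Continuous.aestronglyMeasurable (by fun_prop))
      (ae_of_all _ fun ξ => (Complex.norm_exp_ofReal_mul_I _).le)
  have hgn (ξ : E n) : ‖g ξ‖ₑ = ‖F ξ‖ₑ := by
    rw [← ofReal_norm, ← ofReal_norm, hg, hFT, norm_mul, Complex.norm_exp_ofReal_mul_I, one_mul]
  have hu : halfWave (⇑f) t = fun x => ∫ ξ, planeWave x ξ * g ξ :=
    funext fun x => halfWave_eq_integral_planeWave f t x
  have huc : Continuous (halfWave (⇑f) t) := hu ▸ continuous_integral_planeWave hgi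
  have hS : ENNReal.ofReal (∫ ξ : E n, (1 + ‖ξ‖ ^ 2) ^ s * ‖FT f ξ‖ ^ 2) =
      ∫⁻ ξ, ‖g ξ‖ₑ ^ 2 * ENNReal.ofReal ((1 + ‖ξ‖ ^ 2) ^ s) := by
    rw [hFT, ofReal_integral_eq_lintegral_ofReal (integrable_sobolev_weight_mul_sq F s)
      (ae_of_all _ fun ξ => by positivity)]
    congr with ξ
    rw [ENNReal.ofReal_mul (by positivity), ENNReal.ofReal_pow (norm_nonneg _), ofReal_norm, hgn,
      mul_comm]
  have hS0 : 0 ≤ ∫ ξ : E n, (1 + ‖ξ‖ ^ 2) ^ s * ‖FT f ξ‖ ^ 2 :=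
    integral_nonneg fun ξ => by positivity
  have hL : ∫ x, ‖halfWave (⇑f) t x‖ ^ p ∂μ =
      (∫⁻ x, ‖∫ ξ, planeWave x ξ * g ξ‖ₑ ^ p ∂μ).toReal := by
    rw [integral_eq_lintegral_of_nonneg_ae (ae_of_all _ fun x => by positivity)
      (huc.norm.rpow_const fun x => Or.inr hp0.le).aestronglyMeasurable]
    congr with x
    rw [← ENNReal.ofReal_rpow_of_nonneg (norm_nonneg _) hp0.le, ofReal_norm, hu]
  have key := hC' μ inferInstance hsupp g hgi
  rw [← hS] at key
  have hfin : C * frostman μ α ^ (1 / p) *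
      ENNReal.ofReal (∫ ξ : E n, (1 + ‖ξ‖ ^ 2) ^ s * ‖FT f ξ‖ ^ 2) ^ (1 / 2 : ℝ) ≠ ⊤ :=
    ENNReal.mul_ne_top (ENNReal.mul_ne_top hC
      (ENNReal.rpow_ne_top_of_nonneg (by positivity) hfro.ne))
      (ENNReal.rpow_ne_top_of_nonneg (by norm_num) ENNReal.ofReal_ne_top)
  have hreal := ENNReal.toReal_mono hfin key
  rw [← ENNReal.toReal_rpow, ENNReal.toReal_mul, ENNReal.toReal_mul, ← ENNReal.toReal_rpow,
    ← ENNReal.toReal_rpow, ENNReal.toReal_ofReal hS0, ← hL] at hreal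
  refine hreal.trans ?_
  rw [sobolevNorm]
  gcongr
  linarith
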